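/- arXiv:0706.4038 — 5 statements merged into one kernel-verified Lean document; each statement's English description precedes it below -/
import Mathlib

section
/- For every real λ with λ ≥ (1+√3)/2, the makespan of the Min–Veeravalli–Barlas single-installment schedule is at least that of the proposed schedule: makespan₂(λ) ≥ makespan₁(λ), where makespan₁(λ) = 2λ(λ²+λ+1)/(2λ²+2λ+1) and makespan₂(λ) = λ(4λ+3)/(2(2λ+1)); moreover the inequality is strict for every λ > (1+√3)/2, and equality holds exactly when λ = (1+√3)/2. -/
/-- The gap between the two makespans, with its numerator factored over `ℝ`. -/
theorem makespan_gap {l : ℝ} (hl : 0 < l) :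
    l * (4 * l + 3) / (2 * (2 * l + 1)) -
        2 * l * (l ^ 2 + l + 1) / (2 * l ^ 2 + 2 * l + 1) =
      l * (l - (1 - Real.sqrt 3) / 2) / ((2 * l + 1) * (2 * l ^ 2 + 2 * l + 1)) *
        (l - (1 + Real.sqrt 3) / 2) := by
  have h3 : Real.sqrt 3 ^ 2 = 3 := Real.sq_sqrt (by norm_num)
  have hfac : (l - (1 - Real.sqrt 3) / 2) * (l - (1 + Real.sqrt 3) / 2) =
      (2 * l ^ 2 - 2 * l - 1) / 2 := by
    linear_combination (-1 / 4) * h3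
  have ha : 2 * l + 1 ≠ 0 := by positivity
  have hb : 2 * l ^ 2 + 2 * l + 1 ≠ 0 := by positivity
  rw [div_mul_eq_mul_div, mul_assoc l, hfac]
  field_simp
  ring

/-- For every `l ≥ (1+√3)/2`, the makespan of the Min–Veeravalli–Barlas
single-installment schedule, `makespan₂(l) = l(4l+3)/(2(2l+1))`, is at least the
makespan `makespan₁(l) = 2l(l²+l+1)/(2l²+2l+1)` of the proposed schedule; the
inequality is strict for `l > (1+√3)/2`, and equality holds exactly at
`l = (1+√3)/2`. -/
theorem stmt_1 (makespan₁ makespan₂ : ℝ → ℝ)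
    (h₁ : ∀ l : ℝ, makespan₁ l = 2 * l * (l ^ 2 + l + 1) / (2 * l ^ 2 + 2 * l + 1))
    (h₂ : ∀ l : ℝ, makespan₂ l = l * (4 * l + 3) / (2 * (2 * l + 1))) :
    (∀ l : ℝ, (1 + Real.sqrt 3) / 2 ≤ l → makespan₁ l ≤ makespan₂ l) ∧
    (∀ l : ℝ, (1 + Real.sqrt 3) / 2 < l → makespan₁ l < makespan₂ l) ∧
    (∀ l : ℝ, (1 + Real.sqrt 3) / 2 ≤ l →
      (makespan₂ l = makespan₁ l ↔ l = (1 + Real.sqrt 3) / 2)) := by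
  have h_sqrt : 0 < Real.sqrt 3 := by positivity
  have gap : ∀ l : ℝ, (1 + Real.sqrt 3) / 2 ≤ l →
      ∃ c : ℝ, 0 < c ∧ makespan₂ l - makespan₁ l = c * (l - (1 + Real.sqrt 3) / 2) := by
    intro l hl
    have hl0 : 0 < l := by linarith
    have hconj : 0 < l - (1 - Real.sqrt 3) / 2 := by linarith
    refine ⟨_, ?_, by rw [h₁, h₂, makespan_gap hl0]⟩
    positivity
  refine ⟨fun l hl => ?_, fun l hl => ?_, fun l hl => ?_⟩
  · obtain ⟨c, hc, h⟩ := gap l hl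
    exact sub_nonneg.mp (h ▸ mul_nonneg hc.le (sub_nonneg.mpr hl))
  · obtain ⟨c, hc, h⟩ := gap l hl.le
    exact sub_pos.mp (h ▸ mul_pos hc (sub_pos.mpr hl))
  · obtain ⟨c, hc, h⟩ := gap l hl
    rw [← sub_eq_zero, h, mul_eq_zero, or_iff_right hc.ne', sub_eq_zero]
end

section
/- For every real λ with λ ≥ (1+√3)/2, the gap between the Min–Veeravalli–Barlas makespan and the proposed schedule's makespan is at most one quarter: makespan₂(λ) − makespan₁(λ) ≤ 1/4, where makespan₁(λ) = 2λ(λ²+λ+1)/(2λ²+2λ+1) and makespan₂(λ) = λ(4λ+3)/(2(2λ+1)). -/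
/-- For every `l ≥ (1+√3)/2`, the gap between the Min–Veeravalli–Barlas makespan
`makespan₂(l) = l(4l+3)/(2(2l+1))` and the proposed schedule's makespan
`makespan₁(l) = 2l(l²+l+1)/(2l²+2l+1)` is at most `1/4`. -/
theorem stmt_2 (l : ℝ) (hl : (1 + Real.sqrt 3) / 2 ≤ l) :
    l * (4 * l + 3) / (2 * (2 * l + 1))
      - 2 * l * (l ^ 2 + l + 1) / (2 * l ^ 2 + 2 * l + 1) ≤ 1 / 4 := by
  have hpos : 0 < l := lt_of_lt_of_le (by positivity) hl
  rw [div_sub_div _ _ (by positivity) (by positivity),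
    div_le_div_iff₀ (by positivity) (by positivity)]
  nlinarith [pow_pos hpos 2, pow_pos hpos 3]
end

section
/- Infeasibility of the Min–Veeravalli–Barlas strategy for small λ: for every real λ with 0 < λ < (1+√17)/8 and every natural number Q, the sum over k = 1,…,Q of 2·(λ/(2λ+1))·λ^k is strictly less than 1; hence no finite (and not even an infinite) number of installments suffices to distribute the whole second load. -/
/-- Infeasibility of the Min–Veeravalli–Barlas strategy for small `l`: for every real
`l` with `0 < l < (1+√17)/8` and every natural number `Q`, the sum over `k = 1, …, Q`
of `2·(l/(2l+1))·l^k` is strictly less than `1` — and even the infinite series falls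
short of `1`. Hence no finite (and not even an infinite) number of installments
suffices to distribute the whole second load. -/
theorem stmt_8 (l : ℝ) (hl0 : 0 < l) (hl : l < (1 + Real.sqrt 17) / 8) :
    (∀ Q : ℕ, ∑ k ∈ Finset.Icc 1 Q, 2 * (l / (2 * l + 1)) * l ^ k < 1) ∧
    (∑' k : ℕ, 2 * (l / (2 * l + 1)) * l ^ (k + 1)) < 1 := by
  have hs : Real.sqrt 17 ^ 2 = 17 := Real.sq_sqrt (by norm_num)
  have hs0 : 0 ≤ Real.sqrt 17 := Real.sqrt_nonneg 17
  have hs5 : Real.sqrt 17 < 5 := by nlinarith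
  have hl1 : l < 1 := by linarith
  have hquad : 4 * l ^ 2 - l - 1 < 0 := by
    nlinarith [mul_pos (show 0 < 1 + Real.sqrt 17 - 8 * l by linarith)
      (show 0 < 8 * l + Real.sqrt 17 - 1 by nlinarith)]
  have hsum : HasSum (fun k : ℕ => 2 * (l / (2 * l + 1)) * l ^ (k + 1))
      (2 * (l / (2 * l + 1)) * l * (1 - l)⁻¹) := by
    simpa only [pow_succ', mul_assoc] using
      (hasSum_geometric_of_lt_one hl0.le hl1).mul_left (2 * (l / (2 * l + 1)) * l)
  have hlt : 2 * (l / (2 * l + 1)) * l * (1 - l)⁻¹ < 1 := by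
    have h1 : 0 < 1 - l := by linarith
    have h2 : 0 < 2 * l + 1 := by linarith
    rw [show 2 * (l / (2 * l + 1)) * l * (1 - l)⁻¹ = 2 * l ^ 2 / ((2 * l + 1) * (1 - l)) by
      field_simp, div_lt_one (by positivity)]
    nlinarith
  refine ⟨fun Q => ?_, hsum.tsum_eq ▸ hlt⟩
  rw [← Finset.Ico_add_one_right_eq_Icc, Finset.sum_Ico_eq_sum_range]
  simp only [Nat.add_sub_cancel, add_comm 1]
  exact (sum_le_hasSum _ (fun k _ => by positivity) hsum).trans_lt hlt
end

section
/- Feasibility of the Min–Veeravalli–Barlas strategy above the threshold: for every real λ with λ > (1+√17)/8 and λ ≠ 1, there exists a natural number Q such that the sum over k = 1,…,Q of 2·(λ/(2λ+1))·λ^k is at least 1; that is, finitely many installments suffice to distribute the whole second load. -/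
theorem sum_Icc_one_pow_mul_one_sub {R : Type*} [CommRing R] (x : R) (n : ℕ) :
    (∑ k ∈ Finset.Icc 1 n, x ^ k) * (1 - x) = x - x ^ (n + 1) := by
  induction n with
  | zero => simp
  | succ n ih =>
    rw [Finset.sum_Icc_succ_top (by omega), add_mul, ih]
    ring

/-- Feasibility of the Min–Veeravalli–Barlas strategy above the threshold: for every
real `l` with `l > (1+√17)/8` and `l ≠ 1`, there is a natural number `Q` such that the
sum over `k = 1, …, Q` of `2·(l/(2l+1))·l^k` is at least `1`; i.e. finitely many
installments suffice to distribute the whole second load. -/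
theorem stmt_9 (l : ℝ) (hl : (1 + Real.sqrt 17) / 8 < l) (hl1 : l ≠ 1) :
    ∃ Q : ℕ, 1 ≤ ∑ k ∈ Finset.Icc 1 Q, 2 * (l / (2 * l + 1)) * l ^ k := by
  have h17 : Real.sqrt 17 ^ 2 = 17 := Real.sq_sqrt (by norm_num)
  have hs : 0 ≤ Real.sqrt 17 := Real.sqrt_nonneg 17
  have hpos : 0 < l := by linarith
  have hquad : 0 < 4 * l ^ 2 - l - 1 := by nlinarith
  have hden : 0 < 2 * l + 1 := by linarith
  rcases lt_or_gt_of_ne hl1 with h | h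
  · obtain ⟨n, hn⟩ := exists_pow_lt_of_lt_one (half_pos hquad) h
    refine ⟨n, ?_⟩
    have hsub : 0 < 1 - l := by linarith
    rw [← Finset.mul_sum, eq_div_of_mul_eq hsub.ne' (sum_Icc_one_pow_mul_one_sub l n),
      ← mul_div_assoc, ← mul_div_assoc, div_mul_eq_mul_div, div_div, le_div_iff₀ (by positivity)]
    have hpow : 0 < l ^ n := by positivity
    have hsq : l ^ 2 * l ^ n ≤ l ^ n :=
      mul_le_of_le_one_left hpow.le (pow_le_one₀ hpos.le h.le)
    rw [pow_succ]
    nlinarith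
  · refine ⟨2, ?_⟩
    rw [← Finset.mul_sum, Finset.sum_Icc_succ_top (by norm_num), Finset.Icc_self,
      Finset.sum_singleton, ← mul_div_assoc, div_mul_eq_mul_div, le_div_iff₀ hden]
    norm_num
    nlinarith [mul_pos hpos (sub_pos.2 h), pow_pos hpos 3]
end

section
/- A concrete instance of the theorem that any finite number of installments is suboptimal under a linear cost model: for every real λ > 0 there exist reals α, β₁, β₂ ≥ 0 with α + β₁ + β₂ = 1 such that max( λα, max((1+λ)β₁, β₁ + β₂) + λβ₂ ) < λ(1+λ)/(1+2λ); that is, a two-installment schedule achieves a makespan strictly smaller than the optimal single-installment makespan λ(1+λ)/(1+2λ). -/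
/-- A concrete instance of the theorem that any finite number of installments is
suboptimal under a linear cost model: for every `l > 0` there exist nonnegative reals
`α, β₁, β₂` with `α + β₁ + β₂ = 1` such that the two-installment schedule in which
`P₁` keeps `α` and sends chunks `β₁` then `β₂` to `P₂` has makespan
`max(lα, max((1+l)β₁, β₁+β₂) + lβ₂)` strictly smaller than the optimal
single-installment makespan `l(1+l)/(1+2l)`. -/
theorem stmt_14 (l : ℝ) (hl : 0 < l) :
    ∃ α β₁ β₂ : ℝ, 0 ≤ α ∧ 0 ≤ β₁ ∧ 0 ≤ β₂ ∧ α + β₁ + β₂ = 1 ∧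
      max (l * α) (max ((1 + l) * β₁) (β₁ + β₂) + l * β₂)
        < l * (1 + l) / (1 + 2 * l) := by
  have hD : 0 < 1 + 2 * l + 2 * l ^ 2 := by positivity
  refine ⟨(1 + l + l ^ 2) / (1 + 2 * l + 2 * l ^ 2), l / (1 + 2 * l + 2 * l ^ 2),
    l ^ 2 / (1 + 2 * l + 2 * l ^ 2), by positivity, by positivity, by positivity, ?_, ?_⟩
  · field_simp
    ring
  · have hlt : l * (1 + l + l ^ 2) / (1 + 2 * l + 2 * l ^ 2) < l * (1 + l) / (1 + 2 * l) := by
      rw [div_lt_div_iff₀ hD (by positivity)]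
      nlinarith [pow_pos hl 3]
    have hP₁ : l * ((1 + l + l ^ 2) / (1 + 2 * l + 2 * l ^ 2)) =
        l * (1 + l + l ^ 2) / (1 + 2 * l + 2 * l ^ 2) := by
      ring
    have hstart : l / (1 + 2 * l + 2 * l ^ 2) + l ^ 2 / (1 + 2 * l + 2 * l ^ 2) =
        (1 + l) * (l / (1 + 2 * l + 2 * l ^ 2)) := by
      ring
    have hP₂ : (1 + l) * (l / (1 + 2 * l + 2 * l ^ 2)) + l * (l ^ 2 / (1 + 2 * l + 2 * l ^ 2)) =
        l * (1 + l + l ^ 2) / (1 + 2 * l + 2 * l ^ 2) := by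
      ring
    rw [hstart, max_self, hP₂, hP₁, max_self]
    exact hlt
end
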